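/- Let 𝔥, 𝔱 ⊆ 𝔤 be linear subspaces with 𝔤 = 𝔥 ⊕ 𝔱. Then the cocommutator satisfies the cosymmetry condition δ(X) ∈ 𝔥 ∧ 𝔱 for all X ∈ 𝔥 if and only if both [𝔥^⊥, 𝔥^⊥]_* ⊆ 𝔥^⊥ and [𝔱^⊥, 𝔱^⊥]_* ⊆ 𝔥^⊥ hold in (𝔤*, [·,·]_*). -/

import Mathlib

open TensorProduct

/-- For subspaces `U V ⊆ 𝔤`, the subspace `U ⊗ V` of `𝔤 ⊗ 𝔤` spanned by the
tensors `u ⊗ v` with `u ∈ U`, `v ∈ V`. -/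
def tensorSub {K : Type*} [Field K] {g : Type*} [AddCommGroup g] [Module K g]
    (U V : Submodule K g) : Submodule K (TensorProduct K g g) :=
  Submodule.span K (Set.image2 (fun x y => x ⊗ₜ[K] y) (U : Set g) (V : Set g))

section

variable {K : Type*} [Field K] {g : Type*} [AddCommGroup g] [Module K g]

/-- A tensor over a finite-dimensional space vanishes if all product functionals kill it. -/
theorem tensor_eq_zero_of_forall_dual [FiniteDimensional K g] {z : g ⊗[K] g}
    (hz : ∀ φ ψ : Module.Dual K g, TensorProduct.lid K K (TensorProduct.map φ ψ z) = 0) :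
    z = 0 := by
  let b := Module.finBasis K g
  refine (b.tensorProduct b).ext_elem fun ⟨i, j⟩ => ?_
  have key : (b.tensorProduct b).coord (i, j) =
      (TensorProduct.lid K K).toLinearMap ∘ₗ TensorProduct.map (b.coord i) (b.coord j) := by
    ext x y
    simp [mul_comm]
  simpa [hz] using LinearMap.congr_fun key z

theorem map_mem_tensorSub {U V : Submodule K g} {P Q : g →ₗ[K] g}
    (hP : ∀ x, P x ∈ U) (hQ : ∀ x, Q x ∈ V) (z : g ⊗[K] g) :
    TensorProduct.map P Q z ∈ tensorSub U V := by
  induction z with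
  | zero => simp
  | tmul x y => exact Submodule.subset_span ⟨P x, hP x, Q y, hQ y, rfl⟩
  | add x y hx hy => simpa using add_mem hx hy

theorem tensorSub_le_ker_map {U V : Submodule K g} {φ ψ : Module.Dual K g}
    (hφψ : φ ∈ U.dualAnnihilator ∨ ψ ∈ V.dualAnnihilator) :
    tensorSub U V ≤ LinearMap.ker (TensorProduct.map φ ψ) := by
  refine Submodule.span_le.2 ?_
  rintro _ ⟨x, hx, y, hy, rfl⟩
  rcases hφψ with hφ | hψ
  · simp [(Submodule.mem_dualAnnihilator φ).1 hφ x hx]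
  · simp [(Submodule.mem_dualAnnihilator ψ).1 hψ y hy]

/-- If `P` vanishes on `V` and all product functionals `φ ⊗ ψ` with `φ, ψ ∈ V^⊥` kill `z`, then
`P ⊗ P` kills `z`. -/
theorem map_self_eq_zero [FiniteDimensional K g] {V : Submodule K g} {P : g →ₗ[K] g}
    (hP : ∀ x ∈ V, P x = 0) {z : g ⊗[K] g}
    (hz : ∀ φ ∈ V.dualAnnihilator, ∀ ψ ∈ V.dualAnnihilator,
      TensorProduct.lid K K (TensorProduct.map φ ψ z) = 0) :
    TensorProduct.map P P z = 0 := by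
  have mem (φ : Module.Dual K g) : φ ∘ₗ P ∈ V.dualAnnihilator :=
    (Submodule.mem_dualAnnihilator _).2 fun x hx => by simp [hP x hx]
  refine tensor_eq_zero_of_forall_dual fun φ ψ => ?_
  rw [← LinearMap.comp_apply (TensorProduct.map φ ψ), ← TensorProduct.map_comp]
  exact hz _ (mem φ) _ (mem ψ)

/-- For complementary subspaces `h, t`, the subspace `h ∧ t` consists of the tensors killed by
`h^⊥ ⊗ h^⊥` and `t^⊥ ⊗ t^⊥`. -/
theorem mem_tensorSub_sup_iff [FiniteDimensional K g] {h t : Submodule K g}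
    (hcompl : IsCompl h t) (z : g ⊗[K] g) :
    z ∈ tensorSub h t ⊔ tensorSub t h ↔
      (∀ φ ∈ h.dualAnnihilator, ∀ ψ ∈ h.dualAnnihilator,
        TensorProduct.lid K K (TensorProduct.map φ ψ z) = 0) ∧
      (∀ φ ∈ t.dualAnnihilator, ∀ ψ ∈ t.dualAnnihilator,
        TensorProduct.lid K K (TensorProduct.map φ ψ z) = 0) := by
  constructor
  · intro hz
    have kill {φ ψ : Module.Dual K g}
        (h₁ : φ ∈ h.dualAnnihilator ∨ ψ ∈ t.dualAnnihilator)
        (h₂ : φ ∈ t.dualAnnihilator ∨ ψ ∈ h.dualAnnihilator) :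
        TensorProduct.lid K K (TensorProduct.map φ ψ z) = 0 := by
      have := sup_le (tensorSub_le_ker_map h₁) (tensorSub_le_ker_map h₂) hz
      rw [LinearMap.mem_ker.1 this, map_zero]
    exact ⟨fun φ hφ ψ hψ => kill (.inl hφ) (.inr hψ), fun φ hφ ψ hψ => kill (.inr hψ) (.inl hφ)⟩
  · rintro ⟨hh, ht⟩
    let P := h.projection t hcompl
    let Q := t.projection h hcompl.symm
    have hPQ : P + Q = LinearMap.id :=
      Submodule.projection_add_projection_eq_id hcompl
    have hPP : TensorProduct.map P P z = 0 :=
      map_self_eq_zero (fun x hx => (Submodule.projection_apply_eq_zero_iff hcompl).2 hx) ht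
    have hQQ : TensorProduct.map Q Q z = 0 :=
      map_self_eq_zero
        (fun x hx => (Submodule.projection_apply_eq_zero_iff hcompl.symm).2 hx) hh
    have hz : z = TensorProduct.map P Q z + TensorProduct.map Q P z := by
      have : TensorProduct.map (P + Q) (P + Q) z = z := by simp [hPQ]
      simpa [TensorProduct.map_add_left, TensorProduct.map_add_right, hPP, hQQ, add_comm]
        using this.symm
    have hP x : P x ∈ h := Submodule.projection_apply_mem hcompl x
    have hQ x : Q x ∈ t := Submodule.projection_apply_mem hcompl.symm x
    rw [hz]
    exact Submodule.add_mem_sup (map_mem_tensorSub hP hQ z) (map_mem_tensorSub hQ hP z)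

end

/-- for subspaces `𝔥, 𝔱 ⊆ 𝔤` with `𝔤 = 𝔥 ⊕ 𝔱`, the cocommutator `δ`
(the transpose of the Lie bracket `[·,·]_*` on `𝔤*`) satisfies the cosymmetry condition
`δ(𝔥) ⊆ 𝔥 ∧ 𝔱` if and only if both `[𝔥^⊥, 𝔥^⊥]_* ⊆ 𝔥^⊥` and `[𝔱^⊥, 𝔱^⊥]_* ⊆ 𝔥^⊥`. -/
theorem cosymmetry_iff_dual_bracket_conditions
    (K : Type*) [Field K] (g : Type*) [LieRing g] [LieAlgebra K g]
    [FiniteDimensional K g]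
    [LieRing (Module.Dual K g)] [LieAlgebra K (Module.Dual K g)]
    (δ : g →ₗ[K] TensorProduct K g g)
    (hδ : ∀ (φ ψ : Module.Dual K g) (X : g),
      TensorProduct.lid K K (TensorProduct.map φ ψ (δ X)) = ⁅φ, ψ⁆ X)
    (h t : Submodule K g) (hcompl : IsCompl h t) :
    (∀ X ∈ h, δ X ∈ tensorSub h t ⊔ tensorSub t h) ↔
      ((∀ φ ∈ h.dualAnnihilator, ∀ ψ ∈ h.dualAnnihilator,
          ⁅φ, ψ⁆ ∈ h.dualAnnihilator) ∧
        (∀ φ ∈ t.dualAnnihilator, ∀ ψ ∈ t.dualAnnihilator,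
          ⁅φ, ψ⁆ ∈ h.dualAnnihilator)) := by
  simp only [mem_tensorSub_sup_iff hcompl, hδ, Submodule.mem_dualAnnihilator]
  exact ⟨fun H => ⟨fun φ hφ ψ hψ X hX => (H X hX).1 φ hφ ψ hψ,
      fun φ hφ ψ hψ X hX => (H X hX).2 φ hφ ψ hψ⟩,
    fun H X hX => ⟨fun φ hφ ψ hψ => H.1 φ hφ ψ hψ X hX,
      fun φ hφ ψ hψ => H.2 φ hφ ψ hψ X hX⟩⟩
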